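/- Let G be a connected claw-free graph that is also even-hole-free (no induced even cycle). Then for every k, the token sliding graph TS_k(G) is connected. -/

import Mathlib

open SimpleGraph

/-- A graph is claw-free if no vertex has three pairwise nonadjacent neighbors. -/
def ClawFree {V : Type} (G : SimpleGraph V) : Prop :=
  ¬ ∃ v a b c : V, G.Adj v a ∧ G.Adj v b ∧ G.Adj v c ∧
    a ≠ b ∧ a ≠ c ∧ b ≠ c ∧ ¬G.Adj a b ∧ ¬G.Adj a c ∧ ¬G.Adj b c

/-- `s` is an independent set of `G`. -/
def Indep {V : Type} (G : SimpleGraph V) (s : Set V) : Prop :=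
  ∀ u ∈ s, ∀ v ∈ s, ¬G.Adj u v

/-- Token sliding step between independent sets. -/
def TSStep {V : Type} (G : SimpleGraph V) (I J : Set V) : Prop :=
  Indep G I ∧ Indep G J ∧ ∃ u v : V, G.Adj u v ∧ I \ J = {u} ∧ J \ I = {v}

/-- Token jumping step between independent sets. -/
def TJStep {V : Type} (G : SimpleGraph V) (I J : Set V) : Prop :=
  Indep G I ∧ Indep G J ∧ ∃ u v : V, I \ J = {u} ∧ J \ I = {v}

/-- Reachability under token sliding. -/
def TSReach {V : Type} (G : SimpleGraph V) : Set V → Set V → Prop :=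
  Relation.ReflTransGen (TSStep G)

/-- Reachability under token jumping. -/
def TJReach {V : Type} (G : SimpleGraph V) : Set V → Set V → Prop :=
  Relation.ReflTransGen (TJStep G)

/-- The neighbors of `v` inside the set `B`. -/
def nbrsIn {V : Type} (G : SimpleGraph V) (B : Set V) (v : V) : Set V :=
  {u ∈ B | G.Adj v u}

/-- `Nset G B i` is the set `N_i(B)` of vertices outside `B` with exactly `i` neighbors in `B`. -/
def Nset {V : Type} (G : SimpleGraph V) (B : Set V) (i : ℕ) : Set V :=
  {v | v ∉ B ∧ (nbrsIn G B v).ncard = i}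

/-- The neighborhood of a set. -/
def Nbhd {V : Type} (G : SimpleGraph V) (S : Set V) : Set V :=
  {w | ∃ u ∈ S, G.Adj w u}

/-- An `I`-bad cycle: a chordless `I`-alternating cycle `c 0, c 1, …, c (2n-1), c 0`
with `c j ∈ I` exactly for even `j`. -/
def IsBadCycle {V : Type} (G : SimpleGraph V) (I : Set V) (n : ℕ) (c : ZMod (2*n) → V) : Prop :=
  2 ≤ n ∧ Function.Injective c ∧
  (∀ j : ZMod (2*n), G.Adj (c j) (c (j + 1))) ∧
  (∀ i j : ZMod (2*n), G.Adj (c i) (c j) → j = i + 1 ∨ i = j + 1) ∧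
  (∀ j : ZMod (2*n), c j ∈ I ↔ Even (ZMod.val j))

/-- The part `A = V(C) ∩ I` of the `I`-bipartition of a bad cycle. -/
def cycA {V : Type} {n : ℕ} (c : ZMod (2*n) → V) : Set V :=
  c '' {j | Even (ZMod.val j)}

/-- The part `B = V(C) \ I` of the `I`-bipartition of a bad cycle. -/
def cycB {V : Type} {n : ℕ} (c : ZMod (2*n) → V) : Set V :=
  c '' {j | ¬ Even (ZMod.val j)}

/-- The bad cycle `c` is resolvable with respect to `I`. -/
def Resolvable {V : Type} (G : SimpleGraph V) (I : Set V) {n : ℕ} (c : ZMod (2*n) → V) : Prop :=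
  ∃ I' : Set V, TSReach G I I' ∧ (G.induce (I' ∪ cycB c)).IsAcyclic

/-- A vertex is free w.r.t. `I` if it is outside `I` and has at most one neighbor in `I`. -/
def FreeVert {V : Type} (G : SimpleGraph V) (I : Set V) (v : V) : Prop :=
  v ∉ I ∧ (nbrsIn G I v).ncard ≤ 1

/-- An `I`-augmenting path `x 0, x 1, …, x (2k)`: an `I`-alternating chordless path of
length `2k ≥ 2` whose endpoints are free vertices. -/
def IsAugPath {V : Type} (G : SimpleGraph V) (I : Set V) (k : ℕ) (x : Fin (2*k+1) → V) : Prop :=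
  1 ≤ k ∧ Function.Injective x ∧
  (∀ j : Fin (2*k), G.Adj (x j.castSucc) (x j.succ)) ∧
  (∀ i j : Fin (2*k+1), G.Adj (x i) (x j) → i.val + 1 = j.val ∨ j.val + 1 = i.val) ∧
  (∀ j : Fin (2*k+1), x j ∈ I ↔ Odd j.val) ∧
  FreeVert G I (x 0) ∧ FreeVert G I (x (Fin.last (2*k)))

variable {V : Type} {G : SimpleGraph V}

lemma Indep.mono {s t : Set V} (ht : Indep G t) (h : s ⊆ t) : Indep G s :=
  fun u hu v hv => ht u (h hu) v (h hv)

lemma indep_insert_iff {s : Set V} {a : V} :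
    Indep G (insert a s) ↔ Indep G s ∧ ∀ b ∈ s, ¬G.Adj a b := by
  refine ⟨fun h => ⟨h.mono (Set.subset_insert _ _), fun b hb =>
    h a (Set.mem_insert _ _) b (Set.mem_insert_of_mem _ hb)⟩, ?_⟩
  rintro ⟨hs, ha⟩ u (rfl | hu) v (rfl | hv)
  · exact G.irrefl
  · exact ha v hv
  · exact fun h => ha u hu h.symm
  · exact hs u hu v hv

lemma TSStep.symm {I J : Set V} (h : TSStep G I J) : TSStep G J I := by
  obtain ⟨hI, hJ, u, v, huv, h1, h2⟩ := h
  exact ⟨hJ, hI, v, u, huv.symm, h2, h1⟩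

lemma TSReach.symm {I J : Set V} (h : TSReach G I J) : TSReach G J I :=
  have : Std.Symm (TSStep G) := ⟨fun _ _ => TSStep.symm⟩
  Relation.ReflTransGen.stdSymm.symm _ _ h

/-- Sliding a token along the edge `uv`, the other tokens being at `A`. -/
lemma TSReach.slide {A : Set V} {u v : V} (huv : G.Adj u v) (hu : u ∉ A) (hv : v ∉ A)
    (hAu : Indep G (insert u A)) (hAv : Indep G (insert v A)) :
    TSReach G (insert u A) (insert v A) := by
  refine Relation.ReflTransGen.single ⟨hAu, hAv, u, v, huv, ?_, ?_⟩ <;>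
  · ext x
    have := huv.ne
    simp only [Set.mem_sdiff, Set.mem_insert_iff, Set.mem_singleton_iff]
    grind

/-- In a connected claw-free graph, a token can be moved between two vertices of an
independent set disjoint from the other tokens. -/
lemma ClawFree.tsReach_insert (hcf : ClawFree G) (hconn : G.Connected) {A : Set V} {u v : V}
    (huv : u ≠ v) (hu : u ∉ A) (hv : v ∉ A) (hA : Indep G (insert u (insert v A))) :
    TSReach G (insert u A) (insert v A) := by
  obtain ⟨n, hn⟩ : ∃ n, G.dist u v ≤ n := ⟨_, le_rfl⟩
  induction n generalizing A u v with
  | zero => exact absurd (hconn.dist_eq_zero_iff.mp (Nat.le_zero.mp hn)) huv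
  | succ n ih =>
    obtain ⟨hvA, hu'⟩ := indep_insert_iff.mp hA
    obtain ⟨hA', hv'⟩ := indep_insert_iff.mp hvA
    have huv' : ¬G.Adj u v := hu' v (Set.mem_insert _ _)
    have huA : ∀ b ∈ A, ¬G.Adj u b := fun b hb => hu' b (Set.mem_insert_of_mem _ hb)
    have hclaw : ∀ w a b c : V, G.Adj w a → G.Adj w b → G.Adj w c → a ≠ b → a ≠ c → b ≠ c →
        ¬G.Adj a b → ¬G.Adj a c → ¬G.Adj b c → False := fun w a b c h1 h2 h3 h4 h5 h6 h7 h8 h9 =>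
      hcf ⟨w, a, b, c, h1, h2, h3, h4, h5, h6, h7, h8, h9⟩
    obtain ⟨W, hW⟩ := hconn.exists_walk_length_eq_dist u v
    cases W with
    | nil => exact absurd rfl huv
    | @cons _ p _ hup W =>
    have hWl : W.length ≤ n := by
      rw [Walk.length_cons] at hW
      lia
    have hpA : p ∉ A := fun h => huA p h hup
    by_cases hpv : G.Adj p v
    · have hp : Indep G (insert p A) := indep_insert_iff.mpr ⟨hA', fun b hb hpb =>
        hclaw p u v b hup.symm hpv hpb huv (by rintro rfl; exact hu hb)
          (by rintro rfl; exact hv hb) huv' (huA b hb) (hv' b hb)⟩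
      exact (TSReach.slide hup hu hpA (indep_insert_iff.mpr ⟨hA', huA⟩) hp).trans
        (TSReach.slide hpv hpA hv hp hvA)
    have hpv' : p ≠ v := by rintro rfl; exact huv' hup
    by_cases hp : ∀ b ∈ A, ¬G.Adj p b
    · refine (TSReach.slide hup hu hpA (indep_insert_iff.mpr ⟨hA', huA⟩)
        (indep_insert_iff.mpr ⟨hA', hp⟩)).trans
        (ih hpv' hpA hv (indep_insert_iff.mpr ⟨hvA, ?_⟩) ((dist_le W).trans hWl))
      rintro b (rfl | hb)
      exacts [hpv, hp b hb]
    push Not at hp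
    obtain ⟨a, ha, hpa⟩ := hp
    have hua : u ≠ a := by rintro rfl; exact hu ha
    have hva : v ≠ a := by rintro rfl; exact hv ha
    -- The second vertex of a shortest path from `p` to `v` is equal or adjacent to `a`.
    have hdist : G.dist a v ≤ n := by
      cases W with
      | nil => exact absurd rfl hpv'
      | @cons _ q _ hpq W =>
      have hqu : ¬G.Adj u q := fun h => by
        have := dist_le (Walk.cons h W)
        simp only [Walk.length_cons] at this hW
        lia
      have hqu' : u ≠ q := by
        rintro rfl
        have := dist_le W
        simp only [Walk.length_cons] at this hW
        lia
      rcases eq_or_ne a q with rfl | haq'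
      · exact (dist_le W).trans ((Nat.le_succ _).trans hWl)
      have haq : G.Adj a q := by
        by_contra haq
        exact hclaw p u a q hup.symm hpa hpq hua hqu' haq' (huA a ha) hqu haq
      exact (dist_le (Walk.cons haq W)).trans hWl
    set B := A \ {a} with hB
    have haB : a ∉ B := fun h => h.2 rfl
    have hAB : A = insert a B := (Set.insert_sdiff_self_of_mem ha).symm
    have hBA : B ⊆ A := Set.sdiff_subset
    have hpB : ∀ b ∈ B, ¬G.Adj p b := fun b hb hpb =>
      hclaw p u a b hup.symm hpa hpb hua (by rintro rfl; exact hu (hBA hb))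
        (by rintro rfl; exact haB hb) (huA a ha) (huA b (hBA hb)) (hA' a ha b (hBA hb))
    have hpuB : Indep G (insert u (insert v B)) :=
      hA.mono (Set.insert_subset_insert (Set.insert_subset_insert hBA))
    have hpvB : Indep G (insert p (insert v B)) := by
      refine indep_insert_iff.mpr ⟨hvA.mono (Set.insert_subset_insert hBA), ?_⟩
      rintro b (rfl | hb)
      exacts [hpv, hpB b hb]
    have havB : Indep G (insert a (insert v B)) := hvA.mono (by
      rw [hAB, Set.insert_comm])
    have hpB' : p ∉ insert v B := by
      rintro (h | h)
      exacts [hpv' h, hpA (hBA h)]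
    have huB' : u ∉ insert v B := by
      rintro (h | h)
      exacts [huv h, hu (hBA h)]
    have haB' : a ∉ insert v B := by
      rintro (h | h)
      exacts [hva h.symm, haB h]
    have h1 : TSReach G (insert a (insert u B)) (insert v (insert u B)) := by
      refine ih hva.symm ?_ ?_ ?_ hdist
      · rintro (h | h)
        exacts [hua h.symm, haB h]
      · rintro (h | h)
        exacts [huv h.symm, hv (hBA h)]
      · refine hA.mono ?_
        rw [hAB]
        intro x
        simp only [Set.mem_insert_iff]
        tauto
    have h2 := (TSReach.slide hup huB' hpB' hpuB hpvB).trans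
      (TSReach.slide hpa hpB' haB' hpvB havB)
    rw [hAB, Set.insert_comm u a, Set.insert_comm v a]
    rw [Set.insert_comm v u] at h1
    exact h1.trans h2

/-- The bipartite graph induced by `G` between `I \ J` and `J \ I`. -/
def symmDiffGraph (G : SimpleGraph V) (I J : Set V) : SimpleGraph V where
  Adj x y := G.Adj x y ∧ (x ∈ I \ J ∧ y ∈ J \ I ∨ x ∈ J \ I ∧ y ∈ I \ J)
  symm := ⟨fun _ _ h => ⟨h.1.symm, h.2.symm.imp And.symm And.symm⟩⟩
  loopless := ⟨fun _ h => G.irrefl h.1⟩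

lemma symmDiffGraph_isBipartite (I J : Set V) : (symmDiffGraph G I J).Colorable 2 := by
  classical
  refine (Coloring.mk (fun x => decide (x ∈ I)) ?_ : (symmDiffGraph G I J).Coloring Bool).colorable
  rintro x y ⟨-, ⟨h, h'⟩ | ⟨h, h'⟩⟩
  · simp [h.1, h'.2]
  · simp [h.2, h'.1]

lemma ClawFree.symmDiffGraph_nbrs (hcf : ClawFree G) {I J : Set V} (hI : Indep G I)
    (hJ : Indep G J) {x a b c : V} (ha : (symmDiffGraph G I J).Adj x a)
    (hb : (symmDiffGraph G I J).Adj x b) (hc : (symmDiffGraph G I J).Adj x c) (hab : a ≠ b) :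
    c = a ∨ c = b := by
  by_contra! h
  refine hcf ⟨x, a, b, c, ha.1, hb.1, hc.1, hab, h.1.symm, h.2.symm, ?_⟩
  obtain ⟨-, ⟨hx, ha⟩ | ⟨hx, ha⟩⟩ := ha <;> obtain ⟨-, ⟨hx', hb⟩ | ⟨hx', hb⟩⟩ := hb <;>
    obtain ⟨-, ⟨hx'', hc⟩ | ⟨hx'', hc⟩⟩ := hc <;>
    first
    | exact absurd hx.1 hx'.2
    | exact absurd hx.1 hx''.2
    | exact ⟨hJ _ ha.1 _ hb.1, hJ _ ha.1 _ hc.1, hJ _ hb.1 _ hc.1⟩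
    | exact ⟨hI _ ha.1 _ hb.1, hI _ ha.1 _ hc.1, hI _ hb.1 _ hc.1⟩

lemma ClawFree.symmDiffGraph_isAcyclic (hcf : ClawFree G)
    (hehf : ∀ t : ℕ, 2 ≤ t → ∀ s : Set V, ¬ Nonempty ((G.induce s) ≃g cycleGraph (2*t)))
    {I J : Set V} (hI : Indep G I) (hJ : Indep G J) : (symmDiffGraph G I J).IsAcyclic := by
  rw [isAcyclic_iff_free_cycleGraph]
  rintro n hn ⟨f⟩
  have heven : Even n := by
    by_contra hodd
    have h2 : (cycleGraph n).Colorable 2 := (symmDiffGraph_isBipartite I J).of_hom f.toHom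
    have h3 := chromaticNumber_cycleGraph_of_odd n (by lia) (Nat.not_even_iff_odd.mp hodd)
    have := h2.chromaticNumber_le
    rw [h3] at this
    norm_num at this
  obtain ⟨m, rfl⟩ : ∃ m, n = m + 3 := ⟨n - 3, by lia⟩
  obtain ⟨t, ht⟩ := heven
  have hf : ∀ {i j}, (cycleGraph (m + 3)).Adj i j → (symmDiffGraph G I J).Adj (f i) (f j) :=
    fun h => f.toHom.map_adj h
  have hne : ∀ i : Fin (m + 3), i - 1 ≠ i + 1 := fun i h => by
    have h0 : (1 : Fin (m + 3)) + 1 = 0 := by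
      have h1 : i + (1 + 1) = i + 0 := by
        rw [← add_assoc, ← h]; simp
      exact add_left_cancel h1
    have := congrArg Fin.val h0
    rw [Fin.val_add, Fin.val_one, Fin.val_zero, Nat.mod_eq_of_lt (by lia)] at this
    lia
  have hnext : ∀ i, (symmDiffGraph G I J).Adj (f i) (f (i + 1)) := fun i =>
    hf (by simp [cycleGraph_adj])
  have hprev : ∀ i, (symmDiffGraph G I J).Adj (f i) (f (i - 1)) := fun i =>
    hf (by simp [cycleGraph_adj])
  have hmem : ∀ i, f i ∈ I ∨ f i ∈ J := fun i => (hnext i).2.imp (·.1.1) (·.1.1)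
  have hadj : ∀ i j, G.Adj (f i) (f j) ↔ (cycleGraph (m + 3)).Adj i j := by
    refine fun i j => ⟨fun h => ?_, fun h => (hf h).1⟩
    have hH : (symmDiffGraph G I J).Adj (f i) (f j) := by
      refine ⟨h, ?_⟩
      have hi := (hnext i).2.imp And.left And.left
      have hj := (hnext j).2.imp And.left And.left
      rcases hi with hi | hi <;> rcases hj with hj | hj
      · exact absurd h (hI _ hi.1 _ hj.1)
      · exact .inl ⟨hi, hj⟩
      · exact .inr ⟨hi, hj⟩
      · exact absurd h (hJ _ hi.1 _ hj.1)
    rcases hcf.symmDiffGraph_nbrs hI hJ (hprev i) (hnext i) hH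
      (fun h => hne i (f.injective h)) with h | h <;> rw [f.injective h] <;> simp [cycleGraph_adj]
  refine hehf t (by lia) (Set.range f) ?_
  rw [two_mul, ← ht]
  refine ⟨(⟨Equiv.ofInjective f f.injective, ?_⟩ : cycleGraph (m + 3) ≃g _).symm⟩
  intro i j
  simp [hadj]

/-- A finite acyclic graph with an edge has a vertex with exactly one neighbor. -/
lemma exists_unique_nbr_of_isAcyclic [Finite V] {H : SimpleGraph V} (hH : H.IsAcyclic) {a b : V}
    (hab : H.Adj a b) : ∃ x y, H.Adj x y ∧ ∀ z, H.Adj x z → z = y := by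
  have : Nonempty V := ⟨a⟩
  obtain ⟨u, v, p, hp, hmax⟩ := Walk.exists_isPath_forall_isPath_length_le_length H
  have hlen : 1 ≤ p.length := by
    simpa using hmax _ _ _ (Path.singleton hab).2
  have hnil : ¬p.Nil := by
    rw [← Walk.length_eq_zero_iff]
    lia
  refine ⟨v, p.penultimate, (p.adj_penultimate hnil).symm, fun z hz => ?_⟩
  refine hH.eq_penultimate_of_adj_end hp hz ?_
  by_contra hzp
  have := hmax _ _ _ (hp.concat hzp hz)
  simp at this

/-- Replacing a token of `I` by a vertex of `J` decreases the difference between them. -/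
lemma exchange_facts [Finite V] {I J : Set V} {x y : V} (hx : x ∈ J \ I) (hy : y ∈ I \ J) :
    (insert x (I \ {y})).ncard = I.ncard ∧
      (insert x (I \ {y}) \ J).ncard + 1 = (I \ J).ncard := by
  refine ⟨Set.ncard_exchange hx.2 hy.1, ?_⟩
  have : insert x (I \ {y}) \ J = (I \ J) \ {y} := by
    ext z
    have := hx.1
    simp only [Set.mem_sdiff, Set.mem_insert_iff, Set.mem_singleton_iff]
    grind
  rw [this, Set.ncard_sdiff_singleton_add_one hy]

lemma tsReach_exchange_of_unique_nbr {I J : Set V} (hI : Indep G I) (hJ : Indep G J) {x y : V}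
    (hx : x ∈ J \ I) (hy : y ∈ I \ J) (hxy : G.Adj x y) (huniq : ∀ z ∈ I \ J, G.Adj x z → z = y) :
    Indep G (insert x (I \ {y})) ∧ TSReach G I (insert x (I \ {y})) := by
  have h : Indep G (insert x (I \ {y})) :=
    indep_insert_iff.mpr ⟨hI.mono Set.sdiff_subset, fun b hb hxb =>
      hb.2 (huniq b ⟨hb.1, fun hbJ => hJ x hx.1 b hbJ hxb⟩ hxb)⟩
  have hIy : insert y (I \ {y}) = I := Set.insert_sdiff_self_of_mem hy.1
  have := TSReach.slide hxy.symm (A := I \ {y}) (fun h => h.2 rfl) (fun h => hx.2 h.1)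
    (by rwa [hIy]) h
  rw [hIy] at this
  exact ⟨h, this⟩

/-- For a connected claw-free even-hole-free graph, the token sliding graph `TS_k(G)`
is connected for every `k`. -/
theorem stmt_8 {V : Type} [Fintype V] [DecidableEq V] (G : SimpleGraph V)
    (hconn : G.Connected) (hcf : ClawFree G)
    (hehf : ∀ t : ℕ, 2 ≤ t → ∀ s : Set V, ¬ Nonempty ((G.induce s) ≃g cycleGraph (2*t)))
    (k : ℕ) (I J : Set V) (hI : Indep G I) (hJ : Indep G J)
    (hIk : I.ncard = k) (hJk : J.ncard = k) :
    TSReach G I J := by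
  obtain ⟨n, hn⟩ : ∃ n, (I \ J).ncard ≤ n := ⟨_, le_rfl⟩
  induction n generalizing I J with
  | zero =>
    have hsub : I ⊆ J := Set.sdiff_eq_empty.mp
      ((Set.ncard_eq_zero (Set.toFinite _)).mp (Nat.le_zero.mp hn))
    rw [Set.eq_of_subset_of_ncard_le hsub (by rw [hIk, hJk])]
    exact Relation.ReflTransGen.refl
  | succ n ih =>
    have hcard : (I \ J).ncard = (J \ I).ncard := by
      have h1 := Set.ncard_inter_add_ncard_sdiff_eq_ncard I J
      have h2 := Set.ncard_inter_add_ncard_sdiff_eq_ncard J I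
      rw [Set.inter_comm] at h2
      lia
    by_cases hedge : ∃ a b, (symmDiffGraph G I J).Adj a b
    · obtain ⟨a, b, hab⟩ := hedge
      obtain ⟨x, y, ⟨hxy, h⟩, huniq⟩ :=
        exists_unique_nbr_of_isAcyclic (hcf.symmDiffGraph_isAcyclic hehf hI hJ) hab
      rcases h with ⟨hx, hy⟩ | ⟨hx, hy⟩
      · obtain ⟨hJ', hreach⟩ := tsReach_exchange_of_unique_nbr hJ hI hx hy hxy
          fun z hz hxz => huniq z ⟨hxz, .inl ⟨hx, hz⟩⟩
        obtain ⟨hc, hd⟩ := exchange_facts hx hy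
        exact TSReach.symm (hreach.trans (ih _ _ hJ' hI (hc.trans hJk) hIk (by lia)))
      · obtain ⟨hI', hreach⟩ := tsReach_exchange_of_unique_nbr hI hJ hx hy hxy
          fun z hz hxz => huniq z ⟨hxz, .inr ⟨hx, hz⟩⟩
        obtain ⟨hc, hd⟩ := exchange_facts hx hy
        exact hreach.trans (ih _ _ hI' hJ (hc.trans hIk) hJk (by lia))
    · push Not at hedge
      rcases (I \ J).eq_empty_or_nonempty with h0 | ⟨y, hy⟩
      · exact ih I J hI hJ hIk hJk (by simp [h0])
      obtain ⟨x, hx⟩ : (J \ I).Nonempty := by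
        rw [← Set.ncard_pos, ← hcard, Set.ncard_pos]
        exact ⟨y, hy⟩
      have hIy : insert y (I \ {y}) = I := Set.insert_sdiff_self_of_mem hy.1
      have hxI : Indep G (insert x I) := indep_insert_iff.mpr ⟨hI, fun b hb hxb => by
        by_cases hbJ : b ∈ J
        · exact hJ x hx.1 b hbJ hxb
        · exact hedge x b ⟨hxb, .inr ⟨hx, hb, hbJ⟩⟩⟩
      have hreach := hcf.tsReach_insert hconn (A := I \ {y}) (u := y) (v := x)
        (by rintro rfl; exact hx.2 hy.1) (fun h => h.2 rfl) (fun h => hx.2 h.1)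
        (by rwa [Set.insert_comm, hIy])
      rw [hIy] at hreach
      obtain ⟨hc, hd⟩ := exchange_facts hx hy
      exact hreach.trans (ih _ _ (hxI.mono (Set.insert_subset_insert Set.sdiff_subset)) hJ
        (hc.trans hIk) hJk (by lia))
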